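/- arXiv:2209.09514 — 2 statements merged into one kernel-verified Lean document; each statement's English description precedes it below -/
import Mathlib

section
/- Let L be a finite-dimensional non-abelian nilpotent Lie superalgebra over a field F of characteristic ≠ 2, 3, with dim L = (k | l) and dim L² = (r | s), where L² = [L, L] is the derived subalgebra. Then the total dimension of the non-abelian tensor square satisfies dim(L ⊗ L) ≤ (k + l − (r + s))(k + l − 1) + 2. -/
open Module Function TensorProduct

universe u v w x y z

/-- The sign `(-1)^(ab)` for degrees `a b : ZMod 2`, as an element of the field `F`. -/
def sgn (F : Type u) [Field F] (a b : ZMod 2) : F :=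
  if a = 1 ∧ b = 1 then -1 else 1

/-- A supermodule (ℤ/2-graded vector space) over `F`. -/
class SuperModule (F : Type u) (V : Type v) [Field F] [AddCommGroup V] [Module F V] where
  grade : ZMod 2 → Submodule F V
  isCompl_grade : IsCompl (grade 0) (grade 1)

/-- The graded piece of degree `a`. -/
abbrev gr (F : Type u) (V : Type v) [Field F] [AddCommGroup V] [Module F V]
    [s : SuperModule F V] (a : ZMod 2) : Submodule F V := s.grade a

/-- A Lie superalgebra structure on a supermodule. -/
class LieSuperAlgebra (F : Type u) (L : Type v) [Field F] [AddCommGroup L] [Module F L]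
    [SuperModule F L] where
  bracket : L →ₗ[F] L →ₗ[F] L
  bracket_grade : ∀ (a b : ZMod 2) (x y : L), x ∈ gr F L a → y ∈ gr F L b →
    bracket x y ∈ gr F L (a + b)
  skew : ∀ (a b : ZMod 2) (x y : L), x ∈ gr F L a → y ∈ gr F L b →
    bracket x y = -(sgn F a b) • bracket y x
  jacobi : ∀ (a b c : ZMod 2) (x y zz : L), x ∈ gr F L a → y ∈ gr F L b → zz ∈ gr F L c →
    sgn F a c • bracket x (bracket y zz) + sgn F b a • bracket y (bracket zz x)
      + sgn F c b • bracket zz (bracket x y) = 0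

/-- The bracket of a Lie superalgebra. -/
abbrev br (F : Type u) (L : Type v) [Field F] [AddCommGroup L] [Module F L] [SuperModule F L]
    [s : LieSuperAlgebra F L] : L →ₗ[F] L →ₗ[F] L := s.bracket

/-- A graded submodule. -/
def IsGradedSub (F : Type u) {V : Type v} [Field F] [AddCommGroup V] [Module F V]
    [SuperModule F V] (N : Submodule F V) : Prop :=
  N ≤ (N ⊓ gr F V 0) ⊔ (N ⊓ gr F V 1)

section LSADefs

variable (F : Type u) [Field F]
variable (L : Type v) [AddCommGroup L] [Module F L] [SuperModule F L] [LieSuperAlgebra F L]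

/-- The derived subalgebra `L² = [L, L]`. -/
def derivedSub : Submodule F L := Submodule.span F {t | ∃ x y : L, br F L x y = t}

/-- The center `Z(L)`. -/
def centerSub : Submodule F L := ⨅ x : L, LinearMap.ker ((br F L).flip x)

/-- The span of brackets `[A, B]` of two submodules. -/
def bracketSub (A B : Submodule F L) : Submodule F L :=
  Submodule.span F {t | ∃ x ∈ A, ∃ y ∈ B, br F L x y = t}

/-- Abelian Lie superalgebra. -/
def IsAbelianLSA : Prop := ∀ x y : L, br F L x y = 0

/-- The lower central series. -/
def lcs : ℕ → Submodule F L
  | 0 => ⊤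
  | n + 1 => Submodule.span F {t | ∃ x : L, ∃ y ∈ lcs n, br F L x y = t}

/-- Nilpotent Lie superalgebra. -/
def IsNilpotentLSA : Prop := ∃ n : ℕ, lcs F L n = ⊥

end LSADefs

/-- Homomorphism of Lie superalgebras: an even linear map preserving grading and bracket. -/
structure LieSuperHom (F : Type u) (L : Type v) (M : Type w) [Field F]
    [AddCommGroup L] [Module F L] [SuperModule F L] [LieSuperAlgebra F L]
    [AddCommGroup M] [Module F M] [SuperModule F M] [LieSuperAlgebra F M]
    extends L →ₗ[F] M where
  map_grade : ∀ (a : ZMod 2) (x : L), x ∈ gr F L a → toLinearMap x ∈ gr F M a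
  map_bracket : ∀ x y : L, toLinearMap (br F L x y) = br F M (toLinearMap x) (toLinearMap y)

/-- Isomorphism of Lie superalgebras. -/
def LSAIsomorphic (F : Type u) (L : Type v) (M : Type w) [Field F]
    [AddCommGroup L] [Module F L] [SuperModule F L] [LieSuperAlgebra F L]
    [AddCommGroup M] [Module F M] [SuperModule F M] [LieSuperAlgebra F M] : Prop :=
  ∃ f : LieSuperHom F L M, Function.Bijective f.toLinearMap

/-- `Q` is (a realization of) the quotient `L / L²`, i.e. the abelianization of `L`. -/
def IsQuotientByDerived (F : Type u) (L : Type v) (Q : Type w) [Field F]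
    [AddCommGroup L] [Module F L] [SuperModule F L] [LieSuperAlgebra F L]
    [AddCommGroup Q] [Module F Q] [SuperModule F Q] [LieSuperAlgebra F Q] : Prop :=
  ∃ f : LieSuperHom F L Q, Function.Surjective f.toLinearMap ∧
    LinearMap.ker f.toLinearMap = derivedSub F L

/-- An action of the Lie superalgebra `P` on the Lie superalgebra `M`. -/
structure LieSuperAction (F : Type u) (P : Type v) (M : Type w) [Field F]
    [AddCommGroup P] [Module F P] [SuperModule F P] [LieSuperAlgebra F P]
    [AddCommGroup M] [Module F M] [SuperModule F M] [LieSuperAlgebra F M] where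
  act : P →ₗ[F] M →ₗ[F] M
  act_grade : ∀ (a b : ZMod 2) (p : P) (m : M), p ∈ gr F P a → m ∈ gr F M b →
    act p m ∈ gr F M (a + b)
  act_bracket : ∀ (a b : ZMod 2) (p p' : P) (m : M), p ∈ gr F P a → p' ∈ gr F P b →
    act (br F P p p') m = act p (act p' m) - sgn F a b • act p' (act p m)
  act_lie : ∀ (a b : ZMod 2) (p : P) (m m' : M), p ∈ gr F P a → m ∈ gr F M b →
    act p (br F M m m') = br F M (act p m) m' + sgn F a b • br F M m (act p m')

/-- A trivial action. -/
def LieSuperAction.IsTrivial {F : Type u} {P : Type v} {M : Type w} [Field F]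
    [AddCommGroup P] [Module F P] [SuperModule F P] [LieSuperAlgebra F P]
    [AddCommGroup M] [Module F M] [SuperModule F M] [LieSuperAlgebra F M]
    (α : LieSuperAction F P M) : Prop := ∀ (p : P) (m : M), α.act p m = 0

/-- The trivial action of `P` on `M`. -/
def trivialAction (F : Type u) (P : Type v) (M : Type w) [Field F]
    [AddCommGroup P] [Module F P] [SuperModule F P] [LieSuperAlgebra F P]
    [AddCommGroup M] [Module F M] [SuperModule F M] [LieSuperAlgebra F M] :
    LieSuperAction F P M where
  act := 0
  act_grade := by
    intro a b p m _ _
    simp only [LinearMap.zero_apply]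
    exact (gr F M (a + b)).zero_mem
  act_bracket := by intro a b p p' m _ _; simp
  act_lie := by intro a b p m m' _ _; simp

/-- A Lie superpairing on `M × N` (relative to mutual actions) with values in the
Lie superalgebra `T`; these are exactly the defining relations of the non-abelian
tensor product `M ⊗ N`. -/
structure SuperPairing (F : Type u) (M : Type v) (N : Type w) (T : Type x) [Field F]
    [AddCommGroup M] [Module F M] [SuperModule F M] [LieSuperAlgebra F M]
    [AddCommGroup N] [Module F N] [SuperModule F N] [LieSuperAlgebra F N]
    [AddCommGroup T] [Module F T] [SuperModule F T] [LieSuperAlgebra F T]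
    (α : LieSuperAction F M N) (β : LieSuperAction F N M) where
  pair : M →ₗ[F] N →ₗ[F] T
  pair_grade : ∀ (a b : ZMod 2) (m : M) (n : N), m ∈ gr F M a → n ∈ gr F N b →
    pair m n ∈ gr F T (a + b)
  rel1 : ∀ (a b : ZMod 2) (m m' : M) (n : N), m ∈ gr F M a → m' ∈ gr F M b →
    pair (br F M m m') n = pair m (α.act m' n) - sgn F a b • pair m' (α.act m n)
  rel2 : ∀ (a b c : ZMod 2) (m : M) (n n' : N), m ∈ gr F M a → n ∈ gr F N b → n' ∈ gr F N c →
    pair m (br F N n n') = sgn F c (a + b) • pair (β.act n' m) n - sgn F a b • pair (β.act n m) n'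
  rel3 : ∀ (a b : ZMod 2) (m : M) (n : N) (m' : M) (n' : N), m ∈ gr F M a → n ∈ gr F N b →
    br F T (pair m n) (pair m' n') = - sgn F a b • pair (β.act n m) (α.act m' n')

/-- `T`, together with the pairing `p`, is (a realization of) the non-abelian tensor
product `M ⊗ N`: it satisfies the universal property among Lie superpairings. -/
def IsTensorProductLSA (F : Type u) (M : Type v) (N : Type w) (T : Type x) [Field F]
    [AddCommGroup M] [Module F M] [SuperModule F M] [LieSuperAlgebra F M]
    [AddCommGroup N] [Module F N] [SuperModule F N] [LieSuperAlgebra F N]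
    [AddCommGroup T] [Module F T] [SuperModule F T] [LieSuperAlgebra F T]
    (α : LieSuperAction F M N) (β : LieSuperAction F N M)
    (p : SuperPairing F M N T α β) : Prop :=
  ∀ (T' : Type (max u v w x)) [AddCommGroup T'] [Module F T'] [SuperModule F T']
    [LieSuperAlgebra F T'] (q : SuperPairing F M N T' α β),
    ∃! h : LieSuperHom F T T', ∀ (m : M) (n : N), h.toLinearMap (p.pair m n) = q.pair m n

/-- A Lie superpairing for the tensor square `L ⊗ L` (with adjoint actions):
the defining relations of the non-abelian tensor square. -/
structure TensorSqPairing (F : Type u) (L : Type v) (T : Type w) [Field F]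
    [AddCommGroup L] [Module F L] [SuperModule F L] [LieSuperAlgebra F L]
    [AddCommGroup T] [Module F T] [SuperModule F T] [LieSuperAlgebra F T] where
  pair : L →ₗ[F] L →ₗ[F] T
  pair_grade : ∀ (a b : ZMod 2) (x y : L), x ∈ gr F L a → y ∈ gr F L b →
    pair x y ∈ gr F T (a + b)
  rel1 : ∀ (a b : ZMod 2) (x x' y : L), x ∈ gr F L a → x' ∈ gr F L b →
    pair (br F L x x') y = pair x (br F L x' y) - sgn F a b • pair x' (br F L x y)
  rel2 : ∀ (a b c : ZMod 2) (x y y' : L), x ∈ gr F L a → y ∈ gr F L b → y' ∈ gr F L c →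
    pair x (br F L y y') = sgn F c (a + b) • pair (br F L y' x) y
      - sgn F a b • pair (br F L y x) y'
  rel3 : ∀ (a b : ZMod 2) (x y x' y' : L), x ∈ gr F L a → y ∈ gr F L b →
    br F T (pair x y) (pair x' y') = - sgn F a b • pair (br F L y x) (br F L x' y')

/-- `T`, together with the pairing `p`, is (a realization of) the non-abelian tensor
square `L ⊗ L`. -/
def IsTensorSquare (F : Type u) (L : Type v) (T : Type w) [Field F]
    [AddCommGroup L] [Module F L] [SuperModule F L] [LieSuperAlgebra F L]
    [AddCommGroup T] [Module F T] [SuperModule F T] [LieSuperAlgebra F T]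
    (p : TensorSqPairing F L T) : Prop :=
  ∀ (T' : Type (max u v w)) [AddCommGroup T'] [Module F T'] [SuperModule F T']
    [LieSuperAlgebra F T'] (q : TensorSqPairing F L T'),
    ∃! h : LieSuperHom F T T', ∀ x y : L, h.toLinearMap (p.pair x y) = q.pair x y

/-- The submodule `L □ L` of a realization `T` of `L ⊗ L`, generated by the elements
`x ⊗ x' + (-1)^{|x||x'|} (x' ⊗ x)` (homogeneous `x, x'`) and `x₀ ⊗ x₀` (`x₀` even). -/
def squareBox (F : Type u) (L : Type v) (T : Type w) [Field F]
    [AddCommGroup L] [Module F L] [SuperModule F L] [LieSuperAlgebra F L]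
    [AddCommGroup T] [Module F T] [SuperModule F T] [LieSuperAlgebra F T]
    (p : TensorSqPairing F L T) : Submodule F T :=
  Submodule.span F
    ({t | ∃ (a b : ZMod 2) (x y : L), x ∈ gr F L a ∧ y ∈ gr F L b ∧
        t = p.pair x y + sgn F a b • p.pair y x} ∪
      {t | ∃ x ∈ gr F L 0, t = p.pair x x})

/-- Data of a "universal quadratic functor" target: maps satisfying the defining
relations of `Γ(V)`. -/
structure GammaData (F : Type u) (V : Type v) (W : Type w) [Field F]
    [AddCommGroup V] [Module F V] [SuperModule F V] [AddCommGroup W] [Module F W] where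
  gam : V → W
  bil : V →ₗ[F] V →ₗ[F] W
  gam_smul : ∀ (c : F) (v : V), v ∈ gr F V 0 → gam (c • v) = (c * c) • gam v
  gam_add : ∀ v w' : V, v ∈ gr F V 0 → w' ∈ gr F V 0 →
    gam (v + w') - gam v - gam w' = bil v w'
  bil_symm : ∀ (a b : ZMod 2) (v w' : V), v ∈ gr F V a → w' ∈ gr F V b →
    bil v w' = sgn F a b • bil w' v
  bil_alt : ∀ v : V, v ∈ gr F V 1 → bil v v = 0

/-- `W`, with data `d`, is (a realization of) the universal quadratic functor `Γ(V)`. -/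
def IsGamma (F : Type u) (V : Type v) (W : Type w) [Field F]
    [AddCommGroup V] [Module F V] [SuperModule F V] [AddCommGroup W] [Module F W]
    (d : GammaData F V W) : Prop :=
  ∀ (W' : Type (max u v w)) [AddCommGroup W'] [Module F W'] (d' : GammaData F V W'),
    ∃! h : W →ₗ[F] W',
      (∀ v ∈ gr F V 0, h (d.gam v) = d'.gam v) ∧ (∀ v w' : V, h (d.bil v w') = d'.bil v w')

/-- `Fr` is a free Lie superalgebra on the graded set `(X, deg)` with inclusion `ι`. -/
def IsFreeLSA (F : Type u) (X : Type v) (deg : X → ZMod 2) (Fr : Type w) [Field F]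
    [AddCommGroup Fr] [Module F Fr] [SuperModule F Fr] [LieSuperAlgebra F Fr]
    (ι : X → Fr) : Prop :=
  (∀ x : X, ι x ∈ gr F Fr (deg x)) ∧
  ∀ (K : Type (max u v w)) [AddCommGroup K] [Module F K] [SuperModule F K]
    [LieSuperAlgebra F K] (f : X → K), (∀ x : X, f x ∈ gr F K (deg x)) →
    ∃! h : LieSuperHom F Fr K, ∀ x : X, h.toLinearMap (ι x) = f x

/-- Dimension of the degree-`a` part of the Schur multiplier `(R ∩ [Fr,Fr])/[Fr,R]`
attached to a free presentation with kernel `R`. -/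
noncomputable def schurDim (F : Type u) (Fr : Type v) [Field F] [AddCommGroup Fr]
    [Module F Fr] [SuperModule F Fr] [LieSuperAlgebra F Fr]
    (R : Submodule F Fr) (a : ZMod 2) : ℕ :=
  finrank F ((R ⊓ derivedSub F Fr ⊓ gr F Fr a).map (bracketSub F Fr ⊤ R).mkQ)

/-- `L` is (isomorphic to) the Heisenberg Lie superalgebra `H(m, n)` with even center:
it admits a homogeneous basis `x₁,…,x_{2m}, y₁,…,y_n, z` with the defining brackets. -/
def IsHmn (F : Type u) (m n : ℕ) (L : Type v) [Field F]
    [AddCommGroup L] [Module F L] [SuperModule F L] [LieSuperAlgebra F L] : Prop :=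
  ∃ (xv : Fin (2 * m) → L) (yv : Fin n → L) (zv : L)
    (B : Basis ((Fin (2 * m)) ⊕ (Fin n) ⊕ Unit) F L),
    (∀ i, B (Sum.inl i) = xv i) ∧ (∀ j, B (Sum.inr (Sum.inl j)) = yv j) ∧
    B (Sum.inr (Sum.inr ())) = zv ∧
    (∀ i, xv i ∈ gr F L 0) ∧ (∀ j, yv j ∈ gr F L 1) ∧ zv ∈ gr F L 0 ∧
    (∀ i j : Fin (2 * m), br F L (xv i) (xv j) =
      if (j : ℕ) = (i : ℕ) + m then zv else if (i : ℕ) = (j : ℕ) + m then -zv else 0) ∧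
    (∀ (i : Fin (2 * m)) (j : Fin n), br F L (xv i) (yv j) = 0) ∧
    (∀ (j : Fin n) (i : Fin (2 * m)), br F L (yv j) (xv i) = 0) ∧
    (∀ j k : Fin n, br F L (yv j) (yv k) = if j = k then zv else 0) ∧
    (∀ i, br F L (xv i) zv = 0) ∧ (∀ i, br F L zv (xv i) = 0) ∧
    (∀ j, br F L (yv j) zv = 0) ∧ (∀ j, br F L zv (yv j) = 0) ∧
    br F L zv zv = 0

/-- `L` is (isomorphic to) the Heisenberg Lie superalgebra `H_m` with odd center. -/
def IsHmOdd (F : Type u) (m : ℕ) (L : Type v) [Field F]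
    [AddCommGroup L] [Module F L] [SuperModule F L] [LieSuperAlgebra F L] : Prop :=
  ∃ (xv yv : Fin m → L) (zv : L) (B : Basis ((Fin m) ⊕ (Fin m) ⊕ Unit) F L),
    (∀ i, B (Sum.inl i) = xv i) ∧ (∀ j, B (Sum.inr (Sum.inl j)) = yv j) ∧
    B (Sum.inr (Sum.inr ())) = zv ∧
    (∀ i, xv i ∈ gr F L 0) ∧ (∀ j, yv j ∈ gr F L 1) ∧ zv ∈ gr F L 1 ∧
    (∀ i j, br F L (xv i) (xv j) = 0) ∧
    (∀ i j, br F L (xv i) (yv j) = if i = j then zv else 0) ∧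
    (∀ i j, br F L (yv i) (xv j) = if i = j then -zv else 0) ∧
    (∀ i j, br F L (yv i) (yv j) = 0) ∧
    (∀ i, br F L (xv i) zv = 0) ∧ (∀ i, br F L zv (xv i) = 0) ∧
    (∀ j, br F L (yv j) zv = 0) ∧ (∀ j, br F L zv (yv j) = 0) ∧
    br F L zv zv = 0

/-- `A` is (isomorphic to) the abelian Lie superalgebra `A(a | b)`. -/
def IsAbelianOfDim (F : Type u) (a b : ℕ) (A : Type v) [Field F]
    [AddCommGroup A] [Module F A] [SuperModule F A] [LieSuperAlgebra F A] : Prop :=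
  IsAbelianLSA F A ∧ finrank F (gr F A 0) = a ∧ finrank F (gr F A 1) = b

/-- Heisenberg Lie superalgebra with even center: `Z(L) = L²` is one-dimensional,
spanned by a nonzero even element. -/
def IsHeisenbergEven (F : Type u) (L : Type v) [Field F]
    [AddCommGroup L] [Module F L] [SuperModule F L] [LieSuperAlgebra F L] : Prop :=
  centerSub F L = derivedSub F L ∧
  ∃ zc : L, zc ≠ 0 ∧ zc ∈ gr F L 0 ∧ centerSub F L = Submodule.span F {zc}

/-- Heisenberg Lie superalgebra with odd center. -/
def IsHeisenbergOdd (F : Type u) (L : Type v) [Field F]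
    [AddCommGroup L] [Module F L] [SuperModule F L] [LieSuperAlgebra F L] : Prop :=
  centerSub F L = derivedSub F L ∧
  ∃ zc : L, zc ≠ 0 ∧ zc ∈ gr F L 1 ∧ centerSub F L = Submodule.span F {zc}

/-- `P ≅ L ⊕ M` as Lie superalgebras (internal direct sum of two commuting copies). -/
def IsDirectSumOf (F : Type u) (P : Type v) (L : Type w) (M : Type x) [Field F]
    [AddCommGroup P] [Module F P] [SuperModule F P] [LieSuperAlgebra F P]
    [AddCommGroup L] [Module F L] [SuperModule F L] [LieSuperAlgebra F L]
    [AddCommGroup M] [Module F M] [SuperModule F M] [LieSuperAlgebra F M] : Prop :=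
  ∃ (f : LieSuperHom F L P) (g : LieSuperHom F M P),
    Function.Bijective (fun q : L × M => f.toLinearMap q.1 + g.toLinearMap q.2) ∧
    (∀ (x : L) (y : M), br F P (f.toLinearMap x) (g.toLinearMap y) = 0) ∧
    (∀ (y : M) (x : L), br F P (g.toLinearMap y) (f.toLinearMap x) = 0)

/-- `S ≅ A ⊕ B ⊕ C ⊕ D` as Lie superalgebras. -/
def IsDirectSumOf4 (F : Type u) (S : Type v) (A : Type w) (B : Type x) (C : Type y)
    (D : Type z) [Field F]
    [AddCommGroup S] [Module F S] [SuperModule F S] [LieSuperAlgebra F S]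
    [AddCommGroup A] [Module F A] [SuperModule F A] [LieSuperAlgebra F A]
    [AddCommGroup B] [Module F B] [SuperModule F B] [LieSuperAlgebra F B]
    [AddCommGroup C] [Module F C] [SuperModule F C] [LieSuperAlgebra F C]
    [AddCommGroup D] [Module F D] [SuperModule F D] [LieSuperAlgebra F D] : Prop :=
  ∃ (f : LieSuperHom F A S) (g : LieSuperHom F B S) (h : LieSuperHom F C S)
    (k : LieSuperHom F D S),
    Function.Bijective (fun q : A × B × C × D =>
      f.toLinearMap q.1 + g.toLinearMap q.2.1 + h.toLinearMap q.2.2.1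
        + k.toLinearMap q.2.2.2) ∧
    (∀ u v', br F S (f.toLinearMap u) (g.toLinearMap v') = 0) ∧
    (∀ u v', br F S (f.toLinearMap u) (h.toLinearMap v') = 0) ∧
    (∀ u v', br F S (f.toLinearMap u) (k.toLinearMap v') = 0) ∧
    (∀ u v', br F S (g.toLinearMap u) (h.toLinearMap v') = 0) ∧
    (∀ u v', br F S (g.toLinearMap u) (k.toLinearMap v') = 0) ∧
    (∀ u v', br F S (h.toLinearMap u) (k.toLinearMap v') = 0)

/-- `L ≅ H(m, n) ⊕ A(a | b)`: an internal decomposition into a Heisenberg part with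
even center, spanned by homogeneous elements with the defining brackets, and a central
abelian graded complement of dimension `(a | b)`. -/
def DecompHeisenbergAbelian (F : Type u) (L : Type v) [Field F]
    [AddCommGroup L] [Module F L] [SuperModule F L] [LieSuperAlgebra F L]
    (m n a b : ℕ) : Prop :=
  ∃ (xv : Fin (2 * m) → L) (yv : Fin n → L) (zv : L) (A : Submodule F L),
    (∀ i, xv i ∈ gr F L 0) ∧ (∀ j, yv j ∈ gr F L 1) ∧ zv ∈ gr F L 0 ∧
    IsGradedSub F A ∧
    finrank F (A ⊓ gr F L 0 : Submodule F L) = a ∧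
    finrank F (A ⊓ gr F L 1 : Submodule F L) = b ∧
    (∀ u ∈ A, ∀ v : L, br F L u v = 0 ∧ br F L v u = 0) ∧
    LinearIndependent F (Sum.elim xv (Sum.elim yv (fun _ : Unit => zv))) ∧
    Disjoint (Submodule.span F (Set.range (Sum.elim xv (Sum.elim yv (fun _ : Unit => zv))))) A ∧
    Submodule.span F (Set.range (Sum.elim xv (Sum.elim yv (fun _ : Unit => zv)))) ⊔ A = ⊤ ∧
    (∀ i j : Fin (2 * m), br F L (xv i) (xv j) =
      if (j : ℕ) = (i : ℕ) + m then zv else if (i : ℕ) = (j : ℕ) + m then -zv else 0) ∧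
    (∀ (i : Fin (2 * m)) (j : Fin n), br F L (xv i) (yv j) = 0) ∧
    (∀ (j : Fin n) (i : Fin (2 * m)), br F L (yv j) (xv i) = 0) ∧
    (∀ j k : Fin n, br F L (yv j) (yv k) = if j = k then zv else 0) ∧
    (∀ i, br F L (xv i) zv = 0) ∧ (∀ i, br F L zv (xv i) = 0) ∧
    (∀ j, br F L (yv j) zv = 0) ∧ (∀ j, br F L zv (yv j) = 0) ∧
    br F L zv zv = 0

/-- The submodule of a realization of `I ⊗ J` (for graded ideals `I, J` of `M`)
generated by `x ⊗ y + (-1)^(|x||y|) y ⊗ x` and `x₀ ⊗ x₀` for `x, y, x₀ ∈ I ∩ J`,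
`x₀` even. -/
def pairBox (F : Type u) (I : Type v) (J : Type w) (TIJ : Type x) (M : Type y) [Field F]
    [AddCommGroup I] [Module F I] [SuperModule F I] [LieSuperAlgebra F I]
    [AddCommGroup J] [Module F J] [SuperModule F J] [LieSuperAlgebra F J]
    [AddCommGroup TIJ] [Module F TIJ] [SuperModule F TIJ] [LieSuperAlgebra F TIJ]
    [AddCommGroup M] [Module F M] [SuperModule F M] [LieSuperAlgebra F M]
    (ι : LieSuperHom F I M) (κ : LieSuperHom F J M)
    (α : LieSuperAction F I J) (β : LieSuperAction F J I)
    (p : SuperPairing F I J TIJ α β) : Submodule F TIJ :=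
  Submodule.span F
    ({t | ∃ (a b : ZMod 2) (i i' : I) (j j' : J),
        ι.toLinearMap i = κ.toLinearMap j ∧ ι.toLinearMap i' = κ.toLinearMap j' ∧
        ι.toLinearMap i ∈ gr F M a ∧ ι.toLinearMap i' ∈ gr F M b ∧
        t = p.pair i j' + sgn F a b • p.pair i' j} ∪
      {t | ∃ (i : I) (j : J), ι.toLinearMap i = κ.toLinearMap j ∧
        ι.toLinearMap i ∈ gr F M 0 ∧ t = p.pair i j})

section Aux

variable {F : Type u} [Field F]

lemma z2 (a : ZMod 2) : a = 0 ∨ a = 1 := by revert a; decide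

section Pi
variable {V : Type v} [AddCommGroup V] [Module F V] [SuperModule F V]

variable (F V) in
noncomputable def pj : V →ₗ[F] V :=
  (gr F V 0).projection (gr F V 1) SuperModule.isCompl_grade

lemma pj_mem (x : V) : pj F V x ∈ gr F V 0 := Submodule.projection_apply_mem _ x

lemma pj_zero {x : V} (h : x ∈ gr F V 0) : pj F V x = x :=
  Submodule.projection_apply_of_mem_left _ h

lemma pj_one {x : V} (h : x ∈ gr F V 1) : pj F V x = 0 := by
  unfold pj
  rw [Submodule.projection_apply, (Submodule.projectionOnto_apply_eq_zero_iff _).2 h]; rfl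

lemma sub_pj_mem (x : V) : x - pj F V x ∈ gr F V 1 := by
  have := (Submodule.projectionOnto_apply_eq_zero_iff
    (SuperModule.isCompl_grade (F := F) (V := V)) (x := x - pj F V x)).1 (by
      rw [map_sub, Submodule.projectionOnto_apply_of_mem_left _ (pj_mem x), sub_eq_zero]
      rfl)
  exact this

/-- closed under projections -/
def PjStable (N : Submodule F V) : Prop := ∀ x ∈ N, pj F V x ∈ N

lemma pj_hom {a : ZMod 2} {x : V} (h : x ∈ gr F V a) : pj F V x = x ∨ pj F V x = 0 := by
  rcases z2 a with rfl | rfl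
  · exact Or.inl (pj_zero h)
  · exact Or.inr (pj_one h)

lemma pjStable_span (s : Set V) (h : ∀ x ∈ s, ∃ a, x ∈ gr F V a) :
    PjStable (Submodule.span F s) := by
  intro x hx
  have : Submodule.span F s ≤ (Submodule.span F s).comap (pj F V) := by
    rw [Submodule.span_le]
    intro y hy
    obtain ⟨a, ha⟩ := h y hy
    rcases pj_hom ha with h | h
    · simpa [h] using Submodule.subset_span hy
    · simp [h]
  exact this hx

lemma PjStable.decomp {N : Submodule F V} (h : PjStable N) {x : V} (hx : x ∈ N) :
    ∃ x0 x1, x0 ∈ N ∧ x1 ∈ N ∧ x0 ∈ gr F V 0 ∧ x1 ∈ gr F V 1 ∧ x = x0 + x1 :=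
  ⟨pj F V x, x - pj F V x, h x hx, N.sub_mem hx (h x hx), pj_mem x, sub_pj_mem x, by abel⟩

lemma PjStable.inf {N M : Submodule F V} (h : PjStable N) (h' : PjStable M) :
    PjStable (N ⊓ M) := fun x hx => ⟨h x hx.1, h' x hx.2⟩

lemma top_decomp (x : V) :
    ∃ x0 x1 : V, x0 ∈ gr F V 0 ∧ x1 ∈ gr F V 1 ∧ x = x0 + x1 :=
  ⟨pj F V x, x - pj F V x, pj_mem x, sub_pj_mem x, by abel⟩

lemma PjStable.isCompl {N : Submodule F V} (h : PjStable N) :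
    IsCompl ((gr F V 0).comap N.subtype) ((gr F V 1).comap N.subtype) := by
  have hc := SuperModule.isCompl_grade (F := F) (V := V)
  constructor
  · rw [Submodule.disjoint_def]
    intro x h0 h1
    exact Subtype.ext ((Submodule.disjoint_def.1 hc.disjoint) x h0 h1)
  · rw [codisjoint_iff, eq_top_iff]
    intro x _
    obtain ⟨x0, x1, m0, m1, g0, g1, e⟩ := h.decomp x.2
    rw [Submodule.mem_sup]
    exact ⟨⟨x0, m0⟩, g0, ⟨x1, m1⟩, g1, Subtype.ext e.symm⟩

lemma PjStable.finrank {N : Submodule F V} [FiniteDimensional F V] (h : PjStable N) :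
    finrank F (N ⊓ gr F V 0 : Submodule F V) + finrank F (N ⊓ gr F V 1 : Submodule F V)
      = finrank F N := by
  have hc := SuperModule.isCompl_grade (F := F) (V := V)
  have e : (N ⊓ gr F V 0) ⊔ (N ⊓ gr F V 1) = N := by
    apply le_antisymm (sup_le inf_le_left inf_le_left)
    intro x hx
    obtain ⟨x0, x1, m0, m1, g0, g1, e⟩ := h.decomp hx
    rw [Submodule.mem_sup]
    exact ⟨x0, ⟨m0, g0⟩, x1, ⟨m1, g1⟩, e.symm⟩
  have e2 : (N ⊓ gr F V 0) ⊓ (N ⊓ gr F V 1) = ⊥ := by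
    rw [eq_bot_iff, ← hc.inf_eq_bot]
    exact inf_le_inf inf_le_right inf_le_right
  have := Submodule.finrank_sup_add_finrank_inf_eq (N ⊓ gr F V 0) (N ⊓ gr F V 1)
  rw [e, e2, finrank_bot] at this
  omega

lemma hom_induct {N : Submodule F V} (f : V →ₗ[F] V) (x : V)
    (h : ∀ a, ∀ x ∈ gr F V a, f x ∈ N) : f x ∈ N := by
  obtain ⟨x0, x1, g0, g1, rfl⟩ := top_decomp (F := F) x
  rw [map_add]; exact N.add_mem (h 0 _ g0) (h 1 _ g1)

end Pi

section Lie
variable {L : Type v} [AddCommGroup L] [Module F L] [SuperModule F L] [LieSuperAlgebra F L]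

lemma derived_le {N : Submodule F L}
    (h : ∀ (a b : ZMod 2) (x y : L), x ∈ gr F L a → y ∈ gr F L b → br F L x y ∈ N) :
    derivedSub F L ≤ N := by
  unfold derivedSub
  rw [Submodule.span_le]
  rintro _ ⟨x, y, rfl⟩
  obtain ⟨x0, x1, g0, g1, rfl⟩ := top_decomp (F := F) x
  obtain ⟨y0, y1, k0, k1, rfl⟩ := top_decomp (F := F) y
  simp only [map_add, LinearMap.add_apply]
  exact N.add_mem (N.add_mem (h _ _ _ _ g0 k0) (h _ _ _ _ g1 k0))
    (N.add_mem (h _ _ _ _ g0 k1) (h _ _ _ _ g1 k1))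

lemma br_mem_derived (x y : L) : br F L x y ∈ derivedSub F L :=
  Submodule.subset_span ⟨x, y, rfl⟩

lemma br_mem_lcs {n : ℕ} (x : L) {y : L} (hy : y ∈ lcs F L n) : br F L x y ∈ lcs F L (n + 1) :=
  Submodule.subset_span ⟨x, y, hy, rfl⟩

lemma lcs_le {n : ℕ} {N : Submodule F L} (hn : PjStable (lcs F L n))
    (h : ∀ (a b : ZMod 2) (x y : L), x ∈ gr F L a → y ∈ gr F L b → y ∈ lcs F L n →
      br F L x y ∈ N) :
    lcs F L (n + 1) ≤ N := by
  rw [lcs, Submodule.span_le]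
  rintro _ ⟨x, y, hy, rfl⟩
  obtain ⟨x0, x1, g0, g1, rfl⟩ := top_decomp (F := F) x
  obtain ⟨y0, y1, m0, m1, k0, k1, rfl⟩ := hn.decomp hy
  simp only [map_add, LinearMap.add_apply]
  exact N.add_mem (N.add_mem (h _ _ _ _ g0 k0 m0) (h _ _ _ _ g1 k0 m0))
    (N.add_mem (h _ _ _ _ g0 k1 m1) (h _ _ _ _ g1 k1 m1))

lemma lcs_stable (n : ℕ) : PjStable (lcs F L n) := by
  induction n with
  | zero => intro x _; exact Submodule.mem_top
  | succ n ih =>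
    intro x hx
    refine lcs_le (N := (lcs F L (n + 1)).comap (pj F L)) ih ?_ hx
    intro a b x y hx hy hy'
    have := br_mem_lcs x hy'
    rcases pj_hom (LieSuperAlgebra.bracket_grade a b x y hx hy) with h | h
    · rw [Submodule.mem_comap, h]; exact this
    · rw [Submodule.mem_comap, h]; exact Submodule.zero_mem _

lemma derived_eq : derivedSub F L = lcs F L 1 := by
  simp [derivedSub, lcs]

lemma derived_stable : PjStable (derivedSub F L) := by
  rw [derived_eq]; exact lcs_stable 1

lemma not_derived_le (hnil : IsNilpotentLSA F L) (hnab : ¬ IsAbelianLSA F L) :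
    ¬ derivedSub F L ≤ lcs F L 2 := by
  intro h
  have key : ∀ n, derivedSub F L ≤ lcs F L n := by
    intro n
    induction n with
    | zero => exact le_top
    | succ n ih =>
      refine h.trans ?_
      rw [lcs, Submodule.span_le]
      rintro _ ⟨x, y, hy, rfl⟩
      rw [← derived_eq] at hy
      exact br_mem_lcs x (ih hy)
  obtain ⟨n, hn⟩ := hnil
  apply hnab
  intro x y
  have := key n (br_mem_derived x y)
  rw [hn] at this
  simpa using this

variable {T : Type w} [AddCommGroup T] [Module F T] [SuperModule F T] [LieSuperAlgebra F T]
variable (p : TensorSqPairing F L T)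

lemma antisym_step (a b c : ZMod 2) (x y t : L) (hx : x ∈ gr F L a) (hy : y ∈ gr F L b)
    (ht : t ∈ gr F L c) :
    p.pair (br F L x y) t + sgn F (a + b) c • p.pair t (br F L x y)
    = sgn F a (b + c) • (p.pair (br F L y t) x + sgn F (b + c) a • p.pair x (br F L y t))
    + sgn F c (a + b) • (p.pair (br F L t x) y + sgn F (c + a) b • p.pair y (br F L t x)) := by
  have h1 := p.rel1 a b x y t hx hy
  have h2 := p.rel2 c a b t x y ht hx hy
  have h3 := LieSuperAlgebra.skew a c x t hx ht
  change br F L x t = _ at h3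
  rw [h1, h2, h3]
  have h11 : (1 : ZMod 2) + 1 = 0 := by decide
  simp only [map_smul, LinearMap.smul_apply]
  rcases z2 a with rfl | rfl <;> rcases z2 b with rfl | rfl <;> rcases z2 c with rfl | rfl <;> simp [sgn, h11] <;> module

lemma antisym (hchar2 : ringChar F ≠ 2) (a b c : ZMod 2) (x y t : L) (hx : x ∈ gr F L a)
    (hy : y ∈ gr F L b) (ht : t ∈ gr F L c) :
    p.pair (br F L x y) t + sgn F (a + b) c • p.pair t (br F L x y) = 0 := by
  have h1 := antisym_step p a b c x y t hx hy ht
  have h2 := antisym_step p b c a y t x hy ht hx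
  have h3 := antisym_step p c a b t x y ht hx hy
  have two : (2 : F) ≠ 0 := Ring.two_ne_zero hchar2
  have h11 : (1 : ZMod 2) + 1 = 0 := by decide
  generalize p.pair (br F L x y) t + sgn F (a + b) c • p.pair t (br F L x y) = A at *
  generalize p.pair (br F L y t) x + sgn F (b + c) a • p.pair x (br F L y t) = B at *
  generalize p.pair (br F L t x) y + sgn F (c + a) b • p.pair y (br F L t x) = C at *
  have : (2 : F) • A = 0 := by
    rcases z2 a with rfl | rfl <;> rcases z2 b with rfl | rfl <;> rcases z2 c with rfl | rfl <;> simp [sgn, h11] at h1 h2 h3 <;>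
    first
    | linear_combination (norm := module) h2 + h3
    | linear_combination (norm := module) h2 - h3
    | linear_combination (norm := module) h3 - h2
    | linear_combination (norm := module) - h2 - h3
  exact (smul_eq_zero.1 this).resolve_left two

/-- swapping -/
lemma swap_mem (hchar2 : ringChar F ≠ 2) {R : Submodule F T} {a : ZMod 2} {w : L}
    (hw : w ∈ derivedSub F L) (ha : w ∈ gr F L a) (h : ∀ y, p.pair w y ∈ R) (y : L) :
    p.pair y w ∈ R := by
  -- parity twisted swap
  let π := pj F L
  let M : L → L →ₗ[F] T := fun y =>
    p.pair.flip y + (p.pair y).comp π + (p.pair (π y - (y - π y))).comp (LinearMap.id - π)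
  have key : ∀ y, derivedSub F L ≤ LinearMap.ker (M y) := by
    intro y
    apply derived_le
    intro a b x x' hx hx'
    have hb := LieSuperAlgebra.bracket_grade a b x x' hx hx'
    change br F L x x' ∈ _ at hb
    have h0 := antisym p hchar2 a b 0 x x' (π y) hx hx' (pj_mem y)
    have h1 := antisym p hchar2 a b 1 x x' (y - π y) hx hx' (sub_pj_mem y)
    rw [LinearMap.mem_ker]
    simp only [M, LinearMap.add_apply, LinearMap.flip_apply, LinearMap.comp_apply,
      LinearMap.sub_apply, LinearMap.id_apply]
    generalize a + b = e at *
    rcases z2 e with rfl | rfl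
    · have : π (br F L x x') = br F L x x' := pj_zero hb
      rw [this]
      simp [sgn] at h0 h1 ⊢
      linear_combination (norm := module) h0 + h1
    · have : π (br F L x x') = 0 := pj_one hb
      rw [this]
      simp [sgn] at h0 h1 ⊢
      linear_combination (norm := module) h0 + h1
  rcases z2 a with rfl | rfl
  · have h1 := key y hw
    rw [LinearMap.mem_ker] at h1
    have : π w = w := pj_zero ha
    simp [M, this] at h1
    rw [show p.pair y w = - p.pair w y by linear_combination (norm := module) h1]
    exact R.neg_mem (h y)
  · have h1 := key (π y - (y - π y)) hw
    rw [LinearMap.mem_ker] at h1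
    have h2 : π w = 0 := pj_one ha
    have h3 : π (π y) = π y := pj_zero (pj_mem y)
    simp only [M, LinearMap.add_apply, LinearMap.flip_apply, LinearMap.comp_apply,
      LinearMap.sub_apply, LinearMap.id_apply, h2, h3, map_sub, map_zero] at h1
    have : p.pair y w = - p.pair w (π y - (y - π y)) := by
      simp only [map_sub]
      simp at h1 ⊢
      linear_combination (norm := module) h1
    rw [this]
    exact R.neg_mem (h _)

/-- the main spanning argument -/
lemma main_bound [FiniteDimensional F L] (hchar2 : ringChar F ≠ 2)
    (hnil : IsNilpotentLSA F L) (hnab : ¬ IsAbelianLSA F L)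
    (hspan : ∀ R : Submodule F T, (∀ x y, p.pair x y ∈ R) → R = ⊤) :
    finrank F T ≤ (finrank F L - finrank F (derivedSub F L)) * (finrank F L - 1) + 2 := by
  have hE : lcs F L 2 ≤ derivedSub F L := by
    rw [lcs, Submodule.span_le]
    rintro _ ⟨x, y, hy, rfl⟩
    exact br_mem_derived x y
  obtain ⟨a, b, x, x', hx, hx', hz⟩ : ∃ (a b : ZMod 2) (x y : L), x ∈ gr F L a ∧ y ∈ gr F L b ∧
      br F L x y ∉ lcs F L 2 := by
    by_contra! hcon
    exact not_derived_le hnil hnab (derived_le hcon)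
  have hzD := br_mem_derived (F := F) x x'
  have hzg : br F L x x' ∈ gr F L (a + b) := LieSuperAlgebra.bracket_grade a b x x' hx hx'
  have hz12 := p.rel1 a b x x'
  obtain ⟨z, hzdef⟩ : ∃ z, z = br F L x x' := ⟨_, rfl⟩
  rw [← hzdef] at hz hzD hzg hz12
  -- the functional
  obtain ⟨g, hgE, hgz, hgs⟩ : ∃ g : L →ₗ[F] F, (∀ e ∈ lcs F L 2, g e = 0) ∧ g z = 1 ∧
      PjStable (LinearMap.ker g) := by
    obtain ⟨f, hf, hfE⟩ := Submodule.exists_le_ker_of_notMem hz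
    have hfE' : ∀ e ∈ lcs F L 2, f e = 0 := fun e he => hfE he
    generalize a + b = c at hzg
    rcases z2 c with rfl | rfl
    · refine ⟨(f z)⁻¹ • f.comp (pj F L), ?_, ?_, ?_⟩
      · intro e he
        simp [hfE' _ (lcs_stable 2 e he)]
      · simp [pj_zero hzg, hf]
      · intro y hy
        simpa [pj_zero (pj_mem y)] using hy
    · refine ⟨(f z)⁻¹ • f.comp (LinearMap.id - pj F L), ?_, ?_, ?_⟩
      · intro e he
        simp [hfE' _ (lcs_stable 2 e he), hfE' e he]
      · simp [pj_one hzg, hf]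
      · intro y hy
        simp [pj_zero (pj_mem y)]
  let K : Submodule F L := derivedSub F L ⊓ LinearMap.ker g
  have hKs : PjStable K := derived_stable.inf hgs
  have hEK : lcs F L 2 ≤ K := le_inf hE hgE
  have hDK : ∀ w ∈ derivedSub F L, ∃ c : F, ∃ k ∈ K, w = c • z + k := by
    intro w hw
    refine ⟨g w, w - g w • z, ⟨Submodule.sub_mem _ hw (Submodule.smul_mem _ _ hzD), ?_⟩, by abel⟩
    simp [hgz]
  have hKlt : finrank F K < finrank F (derivedSub F L) := by
    apply Submodule.finrank_lt_finrank_of_lt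
    refine lt_of_le_of_ne inf_le_left ?_
    intro h
    have : z ∈ K := by rw [h]; exact hzD
    have h0 : g z = 0 := this.2
    rw [hgz] at h0
    exact one_ne_zero h0
  obtain ⟨V, hV⟩ := Submodule.exists_isCompl (derivedSub F L)
  have hVd := Submodule.finrank_add_eq_of_isCompl hV
  let Φ : ((V ⊗[F] V) × (F × F)) × (K ⊗[F] V) →ₗ[F] T :=
    LinearMap.coprod
      (LinearMap.coprod (TensorProduct.lift (p.pair.domRestrict₁₂ V V))
        (LinearMap.coprod (LinearMap.toSpanSingleton F T (p.pair x z))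
          (LinearMap.toSpanSingleton F T (p.pair x' z))))
      (TensorProduct.lift (p.pair.domRestrict₁₂ K V))
  let R := LinearMap.range Φ
  have hVV : ∀ v ∈ V, ∀ v' ∈ V, p.pair v v' ∈ R := fun v hv v' hv' =>
    ⟨((⟨v, hv⟩ ⊗ₜ ⟨v', hv'⟩, (0, 0)), 0), by simp [Φ]; rfl⟩
  have hKV : ∀ v ∈ K, ∀ v' ∈ V, p.pair v v' ∈ R := fun v hv v' hv' =>
    ⟨((0, (0, 0)), ⟨v, hv⟩ ⊗ₜ ⟨v', hv'⟩), by simp [Φ]; rfl⟩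
  have hxz : p.pair x z ∈ R := ⟨((0, (1, 0)), 0), by simp [Φ]⟩
  have hxz' : p.pair x' z ∈ R := ⟨((0, (0, 1)), 0), by simp [Φ]⟩
  have hLdec : ∀ y : L, ∃ w ∈ derivedSub F L, ∃ v ∈ V, y = w + v := by
    intro y
    have : y ∈ derivedSub F L ⊔ V := by rw [hV.sup_eq_top]; trivial
    obtain ⟨w, hw, v, hv, e⟩ := Submodule.mem_sup.1 this
    exact ⟨w, hw, v, hv, e.symm⟩
  have hbrD : ∀ y, ∀ w ∈ derivedSub F L, br F L y w ∈ K := by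
    intro y w hw
    rw [derived_eq] at hw
    exact hEK (br_mem_lcs y hw)
  -- K ⊗ L
  have hKL : ∀ k ∈ K, ∀ y, p.pair k y ∈ R := by
    obtain ⟨n, hn⟩ := hnil
    have : ∀ j i, n ≤ i + j → ∀ k ∈ K ⊓ lcs F L i, ∀ y, p.pair k y ∈ R := by
      intro j
      induction j with
      | zero =>
        intro i hi k hk y
        have hbot : ∀ m, lcs F L (n + m) = ⊥ := by
          intro m
          induction m with
          | zero => exact hn
          | succ m ih =>
            rw [← add_assoc, lcs, ih, Submodule.span_eq_bot]
            rintro _ ⟨x, y, hy, rfl⟩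
            rw [(Submodule.mem_bot F).1 hy, map_zero]
        obtain ⟨m, hm⟩ := Nat.exists_eq_add_of_le hi
        have h2 : k ∈ lcs F L i := hk.2
        rw [show i = n + m by omega, hbot m, Submodule.mem_bot] at h2
        rw [h2]; simp
      | succ j ih =>
        intro i hi
        have ih' := ih (i + 1) (by omega)
        have hhom : ∀ c, ∀ k ∈ K ⊓ lcs F L i, k ∈ gr F L c → ∀ y, p.pair k y ∈ R := by
          intro c k hk hkc y
          obtain ⟨w, hw, v, hv, rfl⟩ := hLdec y
          rw [map_add]
          refine R.add_mem ?_ (hKV k hk.1 v hv)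
          have : derivedSub F L ≤ R.comap (p.pair k) := by
            apply derived_le
            intro d e y y' hy hy'
            rw [Submodule.mem_comap, p.rel2 c d e k y y' hkc hy hy']
            refine R.sub_mem (R.smul_mem _ (ih' _ ⟨?_, ?_⟩ _)) (R.smul_mem _ (ih' _ ⟨?_, ?_⟩ _))
            · exact hbrD _ _ hk.1.1
            · exact br_mem_lcs _ hk.2
            · exact hbrD _ _ hk.1.1
            · exact br_mem_lcs _ hk.2
          exact this hw
        intro k hk y
        obtain ⟨k0, k1, m0, m1, g0, g1, rfl⟩ := (hKs.inf (lcs_stable i)).decomp hk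
        rw [map_add]
        exact R.add_mem (hhom 0 k0 m0 g0 y) (hhom 1 k1 m1 g1 y)
    intro k hk y
    exact this n 0 (by omega) k ⟨hk, trivial⟩ y
  have hLK : ∀ k ∈ K, ∀ y, p.pair y k ∈ R := by
    intro k hk y
    obtain ⟨k0, k1, m0, m1, g0, g1, rfl⟩ := hKs.decomp hk
    rw [map_add]
    exact R.add_mem (swap_mem p hchar2 m0.1 g0 (hKL k0 m0) y)
      (swap_mem p hchar2 m1.1 g1 (hKL k1 m1) y)
  have hzL : ∀ y, p.pair z y ∈ R := by
    intro y
    rw [hz12 y hx hx']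
    obtain ⟨c, k, hk, e⟩ := hDK _ (br_mem_derived x' y)
    obtain ⟨c', k', hk', e'⟩ := hDK _ (br_mem_derived x y)
    rw [e, e']
    simp only [map_add, map_smul]
    exact R.sub_mem (R.add_mem (R.smul_mem _ hxz) (hLK k hk _))
      (R.smul_mem _ (R.add_mem (R.smul_mem _ hxz') (hLK k' hk' _)))
  have hLz : ∀ y, p.pair y z ∈ R := swap_mem p hchar2 hzD hzg hzL
  have hDL : ∀ w ∈ derivedSub F L, ∀ y, p.pair w y ∈ R := by
    intro w hw y
    obtain ⟨c, k, hk, rfl⟩ := hDK w hw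
    simp only [map_add, map_smul, LinearMap.add_apply, LinearMap.smul_apply]
    exact R.add_mem (R.smul_mem _ (hzL y)) (hKL k hk y)
  have hLD : ∀ w ∈ derivedSub F L, ∀ y, p.pair y w ∈ R := by
    intro w hw y
    obtain ⟨c, k, hk, rfl⟩ := hDK w hw
    simp only [map_add, map_smul]
    exact R.add_mem (R.smul_mem _ (hLz y)) (hLK k hk y)
  have hRtop : R = ⊤ := by
    apply hspan
    intro y y'
    obtain ⟨w, hw, v, hv, rfl⟩ := hLdec y
    obtain ⟨w', hw', v', hv', rfl⟩ := hLdec y'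
    rw [map_add p.pair w v, LinearMap.add_apply]
    refine R.add_mem (hDL w hw _) ?_
    rw [map_add]
    exact R.add_mem (hLD w' hw' v) (hVV v hv v' hv')
  have hsurj : Function.Surjective Φ := LinearMap.range_eq_top.1 hRtop
  have hfin := LinearMap.finrank_le_finrank_of_surjective hsurj
  simp only [Module.finrank_prod, Module.finrank_tensorProduct, Module.finrank_self] at hfin
  rw [← hVd]
  generalize finrank F (derivedSub F L) = d at *
  generalize finrank F V = q at *
  generalize finrank F K = e at *
  obtain ⟨d, rfl⟩ : ∃ d', d = d' + 1 := ⟨d - 1, by omega⟩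
  have h1 : d + 1 + q - (d + 1) = q := by omega
  have h2 : d + 1 + q - 1 = d + q := by omega
  rw [h1, h2]
  have : e ≤ d := by omega
  nlinarith

end Lie

section Univ
variable {T : Type w} [AddCommGroup T] [Module F T] [SuperModule F T] [LieSuperAlgebra F T]

/-- wrapper for a graded subalgebra -/
structure SubAlg (F : Type u) (T : Type w) [Field F] [AddCommGroup T] [Module F T]
    [SuperModule F T] [LieSuperAlgebra F T] where
  S : Submodule F T
  st : PjStable S
  cl : ∀ x ∈ S, ∀ y ∈ S, br F T x y ∈ S

/-- carrier, universe-lifted -/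
abbrev SubAlg.C (A : SubAlg F T) : Type (max u v w) := ULift.{max u v, w} A.S

/-- inclusion -/
def SubAlg.inc (A : SubAlg F T) : SubAlg.C.{u, v, w} A →ₗ[F] T :=
  A.S.subtype.comp ULift.moduleEquiv.toLinearMap

lemma SubAlg.inc_inj (A : SubAlg F T) {x y : SubAlg.C.{u, v, w} A} (h : A.inc x = A.inc y) :
    x = y := ULift.ext _ _ (Subtype.ext h)

/-- constructor -/
def SubAlg.mk' (A : SubAlg F T) (t : T) (h : t ∈ A.S) : SubAlg.C.{u, v, w} A := ⟨⟨t, h⟩⟩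

lemma SubAlg.inc_mk' (A : SubAlg F T) (t : T) (h : t ∈ A.S) :
    A.inc (SubAlg.mk'.{u, v, w} A t h) = t := rfl

lemma SubAlg.inc_mem (A : SubAlg F T) (x : SubAlg.C.{u, v, w} A) : A.inc x ∈ A.S := x.down.2

instance SubAlg.super (A : SubAlg F T) : SuperModule F (SubAlg.C.{u, v, w} A) where
  grade a := (gr F T a).comap A.inc
  isCompl_grade := by
    have hc := SuperModule.isCompl_grade (F := F) (V := T)
    constructor
    · rw [Submodule.disjoint_def]
      intro x h0 h1
      apply A.inc_inj
      rw [map_zero]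
      exact (Submodule.disjoint_def.1 hc.disjoint) _ h0 h1
    · rw [codisjoint_iff, eq_top_iff]
      intro x _
      obtain ⟨x0, x1, m0, m1, g0, g1, e⟩ := A.st.decomp (A.inc_mem x)
      rw [Submodule.mem_sup]
      exact ⟨A.mk' x0 m0, g0, A.mk' x1 m1, g1, A.inc_inj (by rw [map_add, e]; rfl)⟩

instance SubAlg.lie (A : SubAlg F T) : LieSuperAlgebra F (SubAlg.C.{u, v, w} A) where
  bracket := LinearMap.mk₂ F
    (fun x y => A.mk' (br F T (A.inc x) (A.inc y)) (A.cl _ (A.inc_mem x) _ (A.inc_mem y)))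
    (by intros; apply A.inc_inj; simp [SubAlg.inc_mk'])
    (by intros; apply A.inc_inj; simp [SubAlg.inc_mk'])
    (by intros; apply A.inc_inj; simp [SubAlg.inc_mk'])
    (by intros; apply A.inc_inj; simp [SubAlg.inc_mk'])
  bracket_grade a b x y hx hy := LieSuperAlgebra.bracket_grade (F := F) a b _ _ hx hy
  skew a b x y hx hy := by
    apply A.inc_inj
    rw [map_smul]
    exact LieSuperAlgebra.skew (F := F) a b _ _ hx hy
  jacobi a b c x y z hx hy hz := by
    apply A.inc_inj
    simp only [map_smul, map_add, map_zero]
    exact LieSuperAlgebra.jacobi (F := F) a b c _ _ _ hx hy hz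

lemma SubAlg.inc_br (A : SubAlg F T) (x y : SubAlg.C.{u, v, w} A) :
    A.inc (br F _ x y) = br F T (A.inc x) (A.inc y) := rfl

variable {L : Type v} [AddCommGroup L] [Module F L] [SuperModule F L] [LieSuperAlgebra F L]
variable (p : TensorSqPairing F L T)

/-- restricted pairing -/
def SubAlg.res (A : SubAlg F T) (h : ∀ x y, p.pair x y ∈ A.S) :
    TensorSqPairing F L (SubAlg.C.{u, v, w} A) where
  pair := LinearMap.mk₂ F (fun x y => A.mk' (p.pair x y) (h x y))
    (by intros; apply A.inc_inj; simp [SubAlg.inc_mk'])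
    (by intros; apply A.inc_inj; simp [SubAlg.inc_mk'])
    (by intros; apply A.inc_inj; simp [SubAlg.inc_mk'])
    (by intros; apply A.inc_inj; simp [SubAlg.inc_mk'])
  pair_grade a b x y hx hy := p.pair_grade a b x y hx hy
  rel1 a b x x' y hx hx' := by
    apply A.inc_inj
    rw [map_sub, map_smul]
    exact p.rel1 a b x x' y hx hx'
  rel2 a b c x y y' hx hy hy' := by
    apply A.inc_inj
    rw [map_sub, map_smul, map_smul]
    exact p.rel2 a b c x y y' hx hy hy'
  rel3 a b x y x' y' hx hy := by
    apply A.inc_inj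
    rw [map_smul]
    exact p.rel3 a b x y x' y' hx hy

lemma pair_mem_of_hom {R : Submodule F T}
    (h : ∀ (a b : ZMod 2) (x y : L), x ∈ gr F L a → y ∈ gr F L b → p.pair x y ∈ R) (x y : L) :
    p.pair x y ∈ R := by
  obtain ⟨x0, x1, g0, g1, rfl⟩ := top_decomp (F := F) x
  obtain ⟨y0, y1, k0, k1, rfl⟩ := top_decomp (F := F) y
  simp only [map_add, LinearMap.add_apply]
  exact R.add_mem (R.add_mem (h _ _ _ _ g0 k0) (h _ _ _ _ g1 k0))
    (R.add_mem (h _ _ _ _ g0 k1) (h _ _ _ _ g1 k1))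

lemma tensor_span (hT : IsTensorSquare F L T p) (R : Submodule F T)
    (hR : ∀ x y, p.pair x y ∈ R) : R = ⊤ := by
  let s : Set T := {t | ∃ (a b : ZMod 2) (x y : L), x ∈ gr F L a ∧ y ∈ gr F L b ∧ p.pair x y = t}
  have hs : ∀ x y, p.pair x y ∈ Submodule.span F s :=
    pair_mem_of_hom p fun a b x y hx hy => Submodule.subset_span ⟨a, b, x, y, hx, hy, rfl⟩
  have hsR : Submodule.span F s ≤ R := by
    rw [Submodule.span_le]
    rintro _ ⟨a, b, x, y, hx, hy, rfl⟩
    exact hR x y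
  obtain ⟨A, hAS⟩ : ∃ A : SubAlg F T, A.S = Submodule.span F s := ⟨
    { S := Submodule.span F s
      st := by
        apply pjStable_span
        rintro _ ⟨a, b, x, y, hx, hy, rfl⟩
        exact ⟨_, p.pair_grade a b x y hx hy⟩
      cl := by
        intro t ht t' ht'
        have h1 : Submodule.span F s ≤ (Submodule.span F s).comap ((br F T).flip t') := by
          rw [Submodule.span_le]
          rintro _ ⟨a, b, x, y, hx, hy, rfl⟩
          have h2 : Submodule.span F s ≤ (Submodule.span F s).comap (br F T (p.pair x y)) := by
            rw [Submodule.span_le]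
            rintro _ ⟨a', b', x', y', hx', hy', rfl⟩
            change br F T _ _ ∈ Submodule.span F s
            rw [p.rel3 a b x y x' y' hx hy]
            exact Submodule.smul_mem _ _ (hs _ _)
          exact h2 ht'
        exact h1 ht }, rfl⟩
  obtain ⟨B, hBS⟩ : ∃ B : SubAlg F T, ∀ t, t ∈ B.S := ⟨
    { S := ⊤
      st := fun _ _ => trivial
      cl := fun _ _ _ _ => trivial }, fun _ => trivial⟩
  have hs' : ∀ x y, p.pair x y ∈ A.S := fun x y => hAS ▸ hs x y
  obtain ⟨h, hh, -⟩ := hT (SubAlg.C.{u, v, w} A) (A.res p hs')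
  obtain ⟨h', -, hu⟩ := hT (SubAlg.C.{u, v, w} B) (B.res p fun _ _ => hBS _)
  let f1 : LieSuperHom F T (SubAlg.C.{u, v, w} B) :=
    { toFun := fun t => B.mk' t (hBS _)
      map_add' := fun _ _ => rfl
      map_smul' := fun _ _ => rfl
      map_grade := fun _ _ hx => hx
      map_bracket := fun _ _ => rfl }
  let f2 : LieSuperHom F T (SubAlg.C.{u, v, w} B) :=
    { toFun := fun t => B.mk' (A.inc (h.toLinearMap t)) (hBS _)
      map_add' := fun _ _ => by rw [map_add, map_add]; rfl
      map_smul' := fun _ _ => by rw [map_smul, map_smul]; rfl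
      map_grade := fun a x hx => h.map_grade a x hx
      map_bracket := fun x y => by
        change B.mk' (A.inc (h.toLinearMap (br F T x y))) (hBS _) = _
        apply B.inc_inj
        rw [SubAlg.inc_mk', h.map_bracket]
        rfl }
  have e1 : f1 = h' := hu f1 fun x y => rfl
  have e2 : f2 = h' := hu f2 fun x y => by
    change B.mk' (A.inc (h.toLinearMap (p.pair x y))) (hBS _) = _
    apply B.inc_inj
    rw [SubAlg.inc_mk', hh]
    rfl
  rw [eq_top_iff]
  intro t _
  have e3 : f1.toLinearMap t = f2.toLinearMap t := by rw [e1, e2]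
  have e4 : t = A.inc (h.toLinearMap t) := congrArg (fun x => B.inc x) e3
  rw [e4]
  exact hsR (hAS ▸ A.inc_mem _)

end Univ

end Aux

theorem stmt_0 (F : Type*) [Field F] (hchar2 : ringChar F ≠ 2) (hchar3 : ringChar F ≠ 3)
    (L : Type*) [AddCommGroup L] [Module F L] [SuperModule F L] [LieSuperAlgebra F L] [FiniteDimensional F L]
    (hnil : IsNilpotentLSA F L) (hnab : ¬ IsAbelianLSA F L)
    (k l r s : ℕ)
    (hk : finrank F (gr F L 0) = k) (hl : finrank F (gr F L 1) = l)
    (hr : finrank F (derivedSub F L ⊓ gr F L 0 : Submodule F L) = r)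
    (hs : finrank F (derivedSub F L ⊓ gr F L 1 : Submodule F L) = s)
    (T : Type*) [AddCommGroup T] [Module F T] [SuperModule F T] [LieSuperAlgebra F T]
    (p : TensorSqPairing F L T) (hT : IsTensorSquare F L T p) :
    finrank F T ≤ (k + l - (r + s)) * (k + l - 1) + 2 := by
  have h1 := main_bound p hchar2 hnil hnab (tensor_span p hT)
  have h2 := (derived_stable (F := F) (L := L)).finrank
  have h3 : finrank F (gr F L 0) + finrank F (gr F L 1) = finrank F L :=
    Submodule.finrank_add_eq_of_isCompl SuperModule.isCompl_grade
  rw [hk, hl] at h3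
  rw [hr, hs] at h2
  rw [h2, h3]
  exact h1
end

section
/- For m + n ≥ 2, the non-abelian tensor square of the Heisenberg Lie superalgebra H(m, n) with even center satisfies H(m, n) ⊗ H(m, n) ≅ (H(m, n)/H(m, n)²) ⊗ (H(m, n)/H(m, n)²), where the right-hand side is the non-abelian tensor square of the abelianization. -/
open Module Function TensorProduct

universe u v w x y z

section Helpers

/-- Transport of a supermodule structure to a universe lift. -/
instance uliftSuper (F : Type u) (V : Type v) [Field F] [AddCommGroup V] [Module F V]
    [SuperModule F V] : SuperModule F (ULift.{w} V) where
  grade a := (gr F V a).comap (ULift.moduleEquiv : ULift.{w} V ≃ₗ[F] V).toLinearMap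
  isCompl_grade := by
    have h := SuperModule.isCompl_grade (F := F) (V := V)
    rw [isCompl_iff, Submodule.disjoint_def, codisjoint_iff, Submodule.eq_top_iff'] at *
    refine ⟨fun x h0 h1 => ?_, fun x => ?_⟩
    · have := h.1 _ h0 h1
      exact ULift.ext _ _ this
    · obtain ⟨y, hy, z, hz, hyz⟩ := Submodule.mem_sup.1 (h.2 x.down)
      refine Submodule.mem_sup.2 ⟨ULift.up y, hy, ULift.up z, hz, ?_⟩
      ext
      exact hyz

theorem mem_uliftSuper {F : Type u} {V : Type v} [Field F] [AddCommGroup V] [Module F V]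
    [SuperModule F V] {a : ZMod 2} {x : ULift.{w} V} :
    x ∈ gr F (ULift.{w} V) a ↔ x.down ∈ gr F V a := Iff.rfl

/-- Transport of a Lie superalgebra structure to a universe lift. -/
instance uliftLSA (F : Type u) (V : Type v) [Field F] [AddCommGroup V] [Module F V]
    [SuperModule F V] [LieSuperAlgebra F V] : LieSuperAlgebra F (ULift.{w} V) where
  bracket := LinearMap.mk₂ F (fun x y => ULift.up (br F V x.down y.down))
    (by intros; ext; simp) (by intros; ext; simp) (by intros; ext; simp) (by intros; ext; simp)
  bracket_grade a b x y hx hy :=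
    LieSuperAlgebra.bracket_grade (F := F) a b x.down y.down hx hy
  skew a b x y hx hy := by
    ext
    exact LieSuperAlgebra.skew (F := F) a b x.down y.down hx hy
  jacobi a b c x y t hx hy ht := by
    ext
    exact LieSuperAlgebra.jacobi (F := F) a b c x.down y.down t.down hx hy ht

/-- The model of the tensor square. -/
def Mdl (F : Type u) (κ : Type) (_deg : κ → ZMod 2) : Type u := κ × κ → F

variable (F : Type u) [Field F] (κ : Type) (deg : κ → ZMod 2)

instance : AddCommGroup (Mdl F κ deg) := inferInstanceAs (AddCommGroup (κ × κ → F))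
instance : Module F (Mdl F κ deg) := inferInstanceAs (Module F (κ × κ → F))

instance : SuperModule F (Mdl F κ deg) where
  grade a :=
    { carrier := {g | ∀ i : κ × κ, deg i.1 + deg i.2 ≠ a → g i = 0}
      add_mem' := by
        intro g h hg hh i hi
        show g i + h i = 0
        rw [hg i hi, hh i hi, add_zero]
      zero_mem' := fun i _ => rfl
      smul_mem' := by
        intro c g hg i hi
        show c * g i = 0
        rw [hg i hi, mul_zero] }
  isCompl_grade := by
    rw [isCompl_iff, Submodule.disjoint_def, codisjoint_iff, Submodule.eq_top_iff']
    refine ⟨fun g h0 h1 => ?_, fun g => ?_⟩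
    · funext i
      by_cases h : deg i.1 + deg i.2 = 0
      · exact h1 i (by rw [h]; decide)
      · exact h0 i h
    · refine Submodule.mem_sup.2
        ⟨fun i => if deg i.1 + deg i.2 = 0 then g i else 0, ?_,
         fun i => if deg i.1 + deg i.2 = 0 then 0 else g i, ?_, ?_⟩
      · intro i hi
        simp [hi]
      · intro i hi
        have : deg i.1 + deg i.2 = 0 := by
          generalize deg i.1 + deg i.2 = t at *
          revert t; decide
        simp [this]
      · funext i
        show (if deg i.1 + deg i.2 = 0 then g i else 0)
          + (if deg i.1 + deg i.2 = 0 then 0 else g i) = g i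
        split_ifs <;> simp

theorem mem_mdl {a : ZMod 2} {g : Mdl F κ deg} :
    g ∈ gr F (Mdl F κ deg) a ↔ ∀ i : κ × κ, deg i.1 + deg i.2 ≠ a → g i = 0 := Iff.rfl

instance : LieSuperAlgebra F (Mdl F κ deg) where
  bracket := 0
  bracket_grade := by
    intro a b x y _ _
    exact Submodule.zero_mem _
  skew := by intros; simp
  jacobi := by intros; simp

theorem br_mdl (x y : Mdl F κ deg) : br F (Mdl F κ deg) x y = 0 := rfl

variable {F κ deg}

/-- Composition of homomorphisms. -/
def homComp {A : Type v} {B : Type w} {C : Type x}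
    [AddCommGroup A] [Module F A] [SuperModule F A] [LieSuperAlgebra F A]
    [AddCommGroup B] [Module F B] [SuperModule F B] [LieSuperAlgebra F B]
    [AddCommGroup C] [Module F C] [SuperModule F C] [LieSuperAlgebra F C]
    (g : LieSuperHom F B C) (f : LieSuperHom F A B) : LieSuperHom F A C where
  toLinearMap := g.toLinearMap ∘ₗ f.toLinearMap
  map_grade a x hx := g.map_grade a _ (f.map_grade a x hx)
  map_bracket x y := by
    simp only [LinearMap.comp_apply, f.map_bracket, g.map_bracket]

/-- The map up to the universe lift. -/
def homUp (A : Type v)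
    [AddCommGroup A] [Module F A] [SuperModule F A] [LieSuperAlgebra F A] :
    LieSuperHom F A (ULift.{w} A) where
  toLinearMap := (ULift.moduleEquiv : ULift.{w} A ≃ₗ[F] A).symm.toLinearMap
  map_grade a x hx := hx
  map_bracket x y := rfl

/-- The map down from the universe lift. -/
def homDown (A : Type v)
    [AddCommGroup A] [Module F A] [SuperModule F A] [LieSuperAlgebra F A] :
    LieSuperHom F (ULift.{w} A) A where
  toLinearMap := (ULift.moduleEquiv : ULift.{w} A ≃ₗ[F] A).toLinearMap
  map_grade a x hx := hx
  map_bracket x y := rfl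

/-- Pushforward of a pairing. -/
def pairPush {V : Type v} {A : Type w} {B : Type x}
    [AddCommGroup V] [Module F V] [SuperModule F V] [LieSuperAlgebra F V]
    [AddCommGroup A] [Module F A] [SuperModule F A] [LieSuperAlgebra F A]
    [AddCommGroup B] [Module F B] [SuperModule F B] [LieSuperAlgebra F B]
    (f : LieSuperHom F A B) (p : TensorSqPairing F V A) : TensorSqPairing F V B where
  pair := p.pair.compr₂ f.toLinearMap
  pair_grade a b x y hx hy := f.map_grade _ _ (p.pair_grade a b x y hx hy)
  rel1 a b x x' y hx hx' := by
    simp only [LinearMap.compr₂_apply, p.rel1 a b x x' y hx hx', map_sub, map_smul]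
  rel2 a b c x y y' hx hy hy' := by
    simp only [LinearMap.compr₂_apply, p.rel2 a b c x y y' hx hy hy', map_sub, map_smul]
  rel3 a b x y x' y' hx hy := by
    simp only [LinearMap.compr₂_apply, ← f.map_bracket, p.rel3 a b x y x' y' hx hy, map_smul]

/-- The bilinear map into the model. -/
def mdlBil {V : Type v} [AddCommGroup V] [Module F V] (deg : κ → ZMod 2)
    (c : V →ₗ[F] (κ → F)) : V →ₗ[F] V →ₗ[F] Mdl F κ deg :=
  LinearMap.mk₂ F (fun x y => (fun i => c x i.1 * c y i.2 : Mdl F κ deg))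
    (by intro x x' y; funext i
        show c (x + x') i.1 * c y i.2 = c x i.1 * c y i.2 + c x' i.1 * c y i.2
        simp [add_mul])
    (by intro t x y; funext i
        show c (t • x) i.1 * c y i.2 = t * (c x i.1 * c y i.2)
        simp [mul_assoc])
    (by intro x x' y; funext i
        show c x i.1 * c (x' + y) i.2 = c x i.1 * c x' i.2 + c x i.1 * c y i.2
        simp [mul_add])
    (by intro t x y; funext i
        show c x i.1 * c (t • y) i.2 = t * (c x i.1 * c y i.2)
        simp [mul_left_comm])

theorem mdlBil_left {V : Type v} [AddCommGroup V] [Module F V] (deg : κ → ZMod 2)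
    (c : V →ₗ[F] (κ → F)) (x y : V) (h : c x = 0) : mdlBil deg c x y = 0 := by
  funext i
  show c x i.1 * c y i.2 = 0
  simp [h]

theorem mdlBil_right {V : Type v} [AddCommGroup V] [Module F V] (deg : κ → ZMod 2)
    (c : V →ₗ[F] (κ → F)) (x y : V) (h : c y = 0) : mdlBil deg c x y = 0 := by
  funext i
  show c x i.1 * c y i.2 = 0
  simp [h]

/-- The pairing into the model. -/
def mdlPair {V : Type v}
    [AddCommGroup V] [Module F V] [SuperModule F V] [LieSuperAlgebra F V]
    (c : V →ₗ[F] (κ → F)) (hbr : ∀ x y, c (br F V x y) = 0)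
    (hc : ∀ (a : ZMod 2) (x : V), x ∈ gr F V a → ∀ i, deg i ≠ a → c x i = 0) :
    TensorSqPairing F V (Mdl F κ deg) where
  pair := mdlBil deg c
  pair_grade a b x y hx hy := by
    intro i hi
    show c x i.1 * c y i.2 = 0
    by_cases h : deg i.1 = a
    · by_cases h' : deg i.2 = b
      · exact absurd (by rw [h, h']) hi
      · rw [hc b y hy _ h', mul_zero]
    · rw [hc a x hx _ h, zero_mul]
  rel1 a b x x' y hx hx' := by
    rw [mdlBil_left _ _ _ _ (hbr _ _), mdlBil_right _ _ _ _ (hbr _ _),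
      mdlBil_right _ _ _ _ (hbr _ _), smul_zero, sub_zero]
  rel2 a b c' x y y' hx hy hy' := by
    rw [mdlBil_right _ _ _ _ (hbr _ _), mdlBil_left _ _ _ _ (hbr _ _),
      mdlBil_left _ _ _ _ (hbr _ _), smul_zero, smul_zero, sub_zero]
  rel3 a b x y x' y' hx hy := by
    rw [mdlBil_left _ _ _ _ (hbr _ _), br_mdl, smul_zero]

theorem mdlPair_apply {V : Type v}
    [AddCommGroup V] [Module F V] [SuperModule F V] [LieSuperAlgebra F V]
    (c : V →ₗ[F] (κ → F)) (hbr : ∀ x y, c (br F V x y) = 0)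
    (hc : ∀ (a : ZMod 2) (x : V), x ∈ gr F V a → ∀ i, deg i ≠ a → c x i = 0) (x y : V)
    (i : κ × κ) : (mdlPair c hbr hc).pair x y i = c x i.1 * c y i.2 := rfl

theorem model_main [Fintype κ] [DecidableEq κ] {V : Type v} {T : Type w}
    [AddCommGroup V] [Module F V] [SuperModule F V] [LieSuperAlgebra F V]
    [AddCommGroup T] [Module F T] [SuperModule F T] [LieSuperAlgebra F T]
    (p : TensorSqPairing F V T) (hT : IsTensorSquare F V T p)
    (c : V →ₗ[F] (κ → F)) (hbr : ∀ x y, c (br F V x y) = 0)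
    (hc : ∀ (a : ZMod 2) (x : V), x ∈ gr F V a → ∀ i, deg i ≠ a → c x i = 0)
    (b : κ → V) (hb : ∀ i, b i ∈ gr F V (deg i)) (hcb : ∀ i, c (b i) = Pi.single i 1)
    (hp : ∀ x y, p.pair x y = ∑ i : κ × κ, (c x i.1 * c y i.2) • p.pair (b i.1) (b i.2))
    (hp0 : ∀ x y x' y', br F T (p.pair x y) (p.pair x' y') = 0) :
    LSAIsomorphic F T (Mdl F κ deg) ∧ LSAIsomorphic F (Mdl F κ deg) T := by
  let q := mdlPair c hbr hc
  let gl : Mdl F κ deg →ₗ[F] T :=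
    Fintype.linearCombination F (fun i : κ × κ => p.pair (b i.1) (b i.2))
  have hgl : ∀ g : Mdl F κ deg, gl g = ∑ i : κ × κ, g i • p.pair (b i.1) (b i.2) :=
    fun g => rfl
  let g : LieSuperHom F (Mdl F κ deg) T :=
    { toLinearMap := gl
      map_grade := by
        intro a x hx
        rw [hgl]
        refine Submodule.sum_mem _ fun i _ => ?_
        by_cases h : deg i.1 + deg i.2 = a
        · exact Submodule.smul_mem _ _ (h ▸ p.pair_grade _ _ _ _ (hb i.1) (hb i.2))
        · rw [mem_mdl] at hx
          rw [hx i h, zero_smul]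
          exact Submodule.zero_mem _
      map_bracket := by
        intro x y
        rw [br_mdl, map_zero, hgl, hgl]
        simp only [map_sum, LinearMap.sum_apply, map_smul, LinearMap.smul_apply, hp0, smul_zero,
          Finset.sum_const_zero] }
  have hgq : ∀ x y, g.toLinearMap (q.pair x y) = p.pair x y := by
    intro x y
    show gl _ = _
    rw [hgl, hp]
    rfl
  obtain ⟨h, hh, -⟩ := hT (ULift.{max v w} (Mdl F κ deg)) (pairPush (homUp (Mdl F κ deg)) q)
  let h' : LieSuperHom F T (Mdl F κ deg) := homComp (homDown _) h
  have hh' : ∀ x y, h'.toLinearMap (p.pair x y) = q.pair x y := by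
    intro x y
    show (h.toLinearMap (p.pair x y)).down = _
    rw [hh]
    rfl
  have hgh : ∀ t, g.toLinearMap (h'.toLinearMap t) = t := by
    obtain ⟨k, -, hk⟩ := hT (ULift.{max u v} T) (pairPush (homUp T) p)
    have e1 := hk (homUp (F := F) T) (fun x y => rfl)
    have e2 := hk (homComp (homUp (F := F) T) (homComp g h')) (fun x y => by
      show ULift.up (g.toLinearMap (h'.toLinearMap (p.pair x y))) = ULift.up (p.pair x y)
      rw [hh', hgq])
    intro t
    have e3 : (homComp (homUp (F := F) T : LieSuperHom F T (ULift.{max u v} T)) (homComp g h')).toLinearMap t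
        = (homUp (F := F) T : LieSuperHom F T (ULift.{max u v} T)).toLinearMap t := by
      rw [e2, ← e1]
    exact congrArg ULift.down e3
  have hhg : ∀ s, h'.toLinearMap (g.toLinearMap s) = s := by
    intro s
    show h'.toLinearMap (gl s) = s
    rw [hgl]
    simp only [map_sum, map_smul, hh']
    funext j
    have : ∀ (f : κ × κ → Mdl F κ deg) , (∑ i, f i) j = ∑ i, f i j := by
      intro f
      exact Finset.sum_apply j Finset.univ f
    rw [this]
    rw [Finset.sum_eq_single j]
    · show s j * (c (b j.1) j.1 * c (b j.2) j.2) = s j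
      simp [hcb]
    · intro i _ hij
      show s i * (c (b i.1) j.1 * c (b i.2) j.2) = 0
      rw [hcb, hcb]
      by_cases h1 : i.1 = j.1
      · have h2 : i.2 ≠ j.2 := fun h2 => hij (Prod.ext h1 h2)
        simp [Pi.single_apply, h2.symm]
      · simp [Pi.single_apply, Ne.symm h1]
    · simp
  exact ⟨⟨h', Function.bijective_iff_has_inverse.2 ⟨g.toLinearMap, hgh, hhg⟩⟩,
    ⟨g, Function.bijective_iff_has_inverse.2 ⟨h'.toLinearMap, hhg, hgh⟩⟩⟩

theorem zm1 : ∀ a a' : ZMod 2, a ≠ a' → (a = 0 ∧ a' = 1) ∨ (a = 1 ∧ a' = 0) := by decide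
theorem zm2 : ∀ a s : ZMod 2, s ≠ a → s = a + 1 := by decide
theorem zm3 : ∀ a : ZMod 2, a ≠ a + 1 := by decide

theorem gr_disj {V : Type v} [AddCommGroup V] [Module F V] [SuperModule F V] {a a' : ZMod 2}
    (h : a ≠ a') {x : V} (hx : x ∈ gr F V a) (hx' : x ∈ gr F V a') : x = 0 := by
  have hd := Submodule.disjoint_def.1 (SuperModule.isCompl_grade (F := F) (V := V)).disjoint
  rcases zm1 a a' h with ⟨rfl, rfl⟩ | ⟨rfl, rfl⟩
  · exact hd x hx hx'
  · exact hd x hx' hx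

theorem gr_decomp {V : Type v} [AddCommGroup V] [Module F V] [SuperModule F V] (a : ZMod 2)
    (x : V) : ∃ y ∈ gr F V a, ∃ t ∈ gr F V (a + 1), y + t = x := by
  have hd := codisjoint_iff.1 (SuperModule.isCompl_grade (F := F) (V := V)).codisjoint
  obtain ⟨y, hy, t, ht, h⟩ := Submodule.mem_sup.1 (hd ▸ Submodule.mem_top : x ∈ gr F V 0 ⊔ gr F V 1)
  have : a = 0 ∨ a = 1 := by revert a; decide
  rcases this with rfl | rfl
  · exact ⟨y, hy, t, ht, h⟩
  · exact ⟨t, ht, y, hy, by rw [add_comm]; exact h⟩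

theorem repr_grade {V : Type v} [AddCommGroup V] [Module F V] [SuperModule F V]
    {ι : Type} [Fintype ι] (B : Basis ι F V) (d : ι → ZMod 2) (hB : ∀ i, B i ∈ gr F V (d i))
    (a : ZMod 2) (x : V) (hx : x ∈ gr F V a) (i : ι) (hi : d i ≠ a) : B.repr x i = 0 := by
  classical
  have hs := B.sum_repr x
  rw [← Finset.sum_filter_add_sum_filter_not Finset.univ (fun i => d i = a)] at hs
  set y := ∑ i with d i = a, B.repr x i • B i with hy
  set t := ∑ i with ¬ d i = a, B.repr x i • B i with ht
  have hya : y ∈ gr F V a := by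
    refine Submodule.sum_mem _ fun j hj => Submodule.smul_mem _ _ ?_
    have : d j = a := by simpa using hj
    exact this ▸ hB j
  have hta : t ∈ gr F V (a + 1) := by
    refine Submodule.sum_mem _ fun j hj => Submodule.smul_mem _ _ ?_
    have h1 : d j ≠ a := by simpa using hj
    have : d j = a + 1 := zm2 _ _ h1
    exact this ▸ hB j
  have hta' : t ∈ gr F V a := by
    have : t = x - y := by rw [← hs]; abel
    rw [this]
    exact Submodule.sub_mem _ hx hya
  have h0 : t = 0 := gr_disj (zm3 a) hta' hta
  have : B.repr t i = B.repr x i := by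
    rw [ht]
    simp [Finsupp.single_apply, Finset.sum_ite_eq', hi]
  rw [← this, h0]
  simp

end Helpers

theorem stmt_2 (F : Type*) [Field F] (hchar2 : ringChar F ≠ 2) (hchar3 : ringChar F ≠ 3)
    (m n : ℕ) (hmn : 2 ≤ m + n)
    (L : Type*) [AddCommGroup L] [Module F L] [SuperModule F L] [LieSuperAlgebra F L] (hL : IsHmn F m n L)
    (T : Type*) [AddCommGroup T] [Module F T] [SuperModule F T] [LieSuperAlgebra F T]
    (p : TensorSqPairing F L T) (hT : IsTensorSquare F L T p)
    (Q : Type*) [AddCommGroup Q] [Module F Q] [SuperModule F Q] [LieSuperAlgebra F Q] (hQ : IsQuotientByDerived F L Q)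
    (TQ : Type*) [AddCommGroup TQ] [Module F TQ] [SuperModule F TQ] [LieSuperAlgebra F TQ]
    (pQ : TensorSqPairing F Q TQ) (hTQ : IsTensorSquare F Q TQ pQ) :
    LSAIsomorphic F T TQ := by
  classical
  obtain ⟨xv, yv, zv, B, hBx, hBy, hBz, hx0, hy1, hz0, hxx, hxy, hyx, hyy, hxz, hzx, hyz, hzy,
    hzz⟩ := hL
  let κ := Fin (2 * m) ⊕ Fin n
  let em : κ → Fin (2 * m) ⊕ Fin n ⊕ Unit := Sum.map id Sum.inl
  let dg : κ → ZMod 2 := Sum.elim (fun _ => 0) (fun _ => 1)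
  let dB : Fin (2 * m) ⊕ Fin n ⊕ Unit → ZMod 2 := Sum.elim (fun _ => 0)
    (Sum.elim (fun _ => 1) (fun _ => 0))
  have hdB : ∀ i, B i ∈ gr F L (dB i) := by
    rintro (i | i | i)
    · rw [hBx]; exact hx0 i
    · rw [hBy]; exact hy1 i
    · rw [hBz]; exact hz0
  have hdem : ∀ i, dB (em i) = dg i := by
    rintro (i | i) <;> rfl
  let c : L →ₗ[F] (κ → F) := LinearMap.pi fun i => B.coord (em i)
  have hcapp : ∀ x i, c x i = B.repr x (em i) := fun x i => rfl
  let b : κ → L := fun i => B (em i)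
  have hb : ∀ i, b i ∈ gr F L (dg i) := fun i => hdem i ▸ hdB (em i)
  have hem : Function.Injective em := Sum.map_injective.2 ⟨Function.injective_id, Sum.inl_injective⟩
  have hcb : ∀ i, c (b i) = Pi.single i 1 := by
    intro i
    funext j
    rw [hcapp, B.repr_self, Finsupp.single_apply, Pi.single_apply]
    by_cases h : i = j
    · simp [h]
    · rw [if_neg (fun h' => h (hem h')), if_neg (Ne.symm h)]
  have hcz : c zv = 0 := by
    funext j
    rw [hcapp, ← hBz, B.repr_self]
    rcases j with j | j <;> simp [em]
  have hdec : ∀ x, x = (∑ i, c x i • b i) + B.repr x (Sum.inr (Sum.inr ())) • zv := by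
    intro x
    conv_lhs => rw [← B.sum_repr x]
    rw [Fintype.sum_sum_type, Fintype.sum_sum_type, ← add_assoc]
    have h := Fintype.sum_sum_type (fun i : Fin (2 * m) ⊕ Fin n => c x i • b i)
    refine congrArg₂ (· + ·) h.symm ?_
    rw [← hBz, Fintype.sum_unique]
  have hcgr : ∀ (a : ZMod 2) (x : L), x ∈ gr F L a → ∀ i, dg i ≠ a → c x i = 0 := by
    intro a x hx i hi
    exact repr_grade B dB hdB a x hx (em i) (by rw [hdem]; exact hi)
  -- brackets
  have hbrB : ∀ i j, ∃ t : F, br F L (B i) (B j) = t • zv := by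
    rintro (i | i | i) (j | j | j) <;> simp only [hBx, hBy, hBz, hxx, hxy, hyx, hyy, hxz, hzx, hyz,
      hzy, hzz]
    case inl.inl =>
      split_ifs
      exacts [⟨1, by simp⟩, ⟨-1, by simp⟩, ⟨0, by simp⟩]
    case inr.inl.inr.inl =>
      split_ifs
      exacts [⟨1, by simp⟩, ⟨0, by simp⟩]
    all_goals exact ⟨0, by simp⟩
  have hcbr : ∀ x y, c (br F L x y) = 0 := by
    have : (br F L).compr₂ c = 0 := by
      refine B.ext fun i => B.ext fun j => ?_
      obtain ⟨t, ht⟩ := hbrB i j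
      simp [ht, hcz]
    intro x y
    exact LinearMap.congr_fun (LinearMap.congr_fun this x) y
  have hbrz : ∀ x y, ∃ t : F, br F L x y = t • zv := by
    intro x y
    refine ⟨B.repr (br F L x y) (Sum.inr (Sum.inr ())), (hdec (br F L x y)).trans ?_⟩
    rw [hcbr]
    simp only [Pi.zero_apply, zero_smul, Finset.sum_const_zero, zero_add]
  -- z is a suitable bracket
  have hcentral : ∀ x, br F L x zv = 0 := by
    have : (br F L).flip zv = 0 := by
      refine B.ext fun i => ?_
      rcases i with i | i | i <;> simp [hBx, hBy, hBz, hxz, hyz, hzz]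
    exact fun x => LinearMap.congr_fun this x
  have hX : ∀ k (hk : k < m), ∃ u w : L, u ∈ gr F L 0 ∧ w ∈ gr F L 0 ∧ br F L u w = zv ∧
      (∀ j, br F L u (yv j) = 0 ∧ br F L w (yv j) = 0) ∧
      (∀ i : Fin (2 * m), (i : ℕ) ≠ k → (i : ℕ) ≠ k + m →
        br F L u (xv i) = 0 ∧ br F L w (xv i) = 0) := by
    intro k hk
    refine ⟨xv ⟨k, by omega⟩, xv ⟨k + m, by omega⟩, hx0 _, hx0 _, by simp [hxx],
      fun j => ⟨hxy _ _, hxy _ _⟩, fun i h1 h2 => ?_⟩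
    have := i.2
    simp only [hxx]
    constructor
    · rw [if_neg (by omega), if_neg (by omega)]
    · rw [if_neg (by omega), if_neg (by omega)]
  have key : ∀ i, ∃ (a : ZMod 2) (u w : L), u ∈ gr F L a ∧ w ∈ gr F L a ∧ br F L u w = zv ∧
      br F L u (B i) = 0 ∧ br F L w (B i) = 0 := by
    rintro (i | j | i)
    · rw [hBx]
      rcases Nat.eq_zero_or_pos n with hn | hn
      · have : ∃ k, k < m ∧ (i : ℕ) ≠ k ∧ (i : ℕ) ≠ k + m := by
          by_cases h : (i : ℕ) = 0 ∨ (i : ℕ) = m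
          · exact ⟨1, by omega, by omega, by omega⟩
          · exact ⟨0, by omega, by omega, by omega⟩
        obtain ⟨k, hk, h1, h2⟩ := this
        obtain ⟨u, w, hu, hw, huw, -, h⟩ := hX k hk
        exact ⟨0, u, w, hu, hw, huw, (h i h1 h2).1, (h i h1 h2).2⟩
      · exact ⟨1, yv ⟨0, hn⟩, yv ⟨0, hn⟩, hy1 _, hy1 _, by simp [hyy], hyx _ _, hyx _ _⟩
    · rw [hBy]
      rcases Nat.eq_zero_or_pos m with hm | hm
      · have : ∃ k : Fin n, k ≠ j := by
          by_cases h : (j : ℕ) = 0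
          · exact ⟨⟨1, by omega⟩, fun h' => by rw [← h'] at h; simp at h⟩
          · exact ⟨⟨0, by omega⟩, fun h' => h (by rw [← h'])⟩
        obtain ⟨k, hk⟩ := this
        exact ⟨1, yv k, yv k, hy1 _, hy1 _, by simp [hyy], by simp [hyy, hk], by simp [hyy, hk]⟩
      · obtain ⟨u, w, hu, hw, huw, h, -⟩ := hX 0 hm
        exact ⟨0, u, w, hu, hw, huw, (h j).1, (h j).2⟩
    · rw [hBz]
      rcases Nat.eq_zero_or_pos m with hm | hm
      · have hn : 0 < n := by omega
        exact ⟨1, yv ⟨0, hn⟩, yv ⟨0, hn⟩, hy1 _, hy1 _, by simp [hyy], hcentral _, hcentral _⟩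
      · obtain ⟨u, w, hu, hw, huw, -, -⟩ := hX 0 hm
        exact ⟨0, u, w, hu, hw, huw, hcentral _, hcentral _⟩
  have hpz : ∀ y, p.pair zv y = 0 := by
    have : p.pair zv = 0 := by
      refine B.ext fun i => ?_
      obtain ⟨a, u, w, hu, hw, huw, h1, h2⟩ := key i
      rw [← huw, p.rel1 a a u w _ hu hw, h1, h2]
      simp
    intro y
    rw [this]; rfl
  have hzp : ∀ x, p.pair x zv = 0 := by
    have : p.pair.flip zv = 0 := by
      refine B.ext fun i => ?_
      obtain ⟨a, u, w, hu, hw, huw, h1, h2⟩ := key i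
      rw [LinearMap.flip_apply, ← huw, p.rel2 (dB i) a a _ u w (hdB i) hu hw, h1, h2]
      simp
    exact fun x => LinearMap.congr_fun this x
  have hp : ∀ x y, p.pair x y = ∑ i : κ × κ, (c x i.1 * c y i.2) • p.pair (b i.1) (b i.2) := by
    intro x y
    conv_lhs => rw [hdec x, hdec y]
    simp only [map_add, map_smul, LinearMap.add_apply, LinearMap.smul_apply, hpz, hzp, smul_zero,
      add_zero, map_sum, LinearMap.sum_apply, Finset.sum_const_zero]
    rw [Fintype.sum_prod_type_right]
    simp only [Finset.smul_sum, smul_smul]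
    refine Finset.sum_congr rfl fun j _ => Finset.sum_congr rfl fun i _ => ?_
    rw [mul_comm]
  have hpB : ∀ i j x' y', br F T (p.pair (B i) (B j)) (p.pair x' y') = 0 := by
    intro i j x' y'
    obtain ⟨t, ht⟩ := hbrz (B j) (B i)
    rw [p.rel3 _ _ _ _ _ _ (hdB i) (hdB j), ht]
    simp [hpz]
  have hp0 : ∀ x y x' y', br F T (p.pair x y) (p.pair x' y') = 0 := by
    intro x y x' y'
    rw [hp x y]
    simp only [map_sum, LinearMap.sum_apply, map_smul, LinearMap.smul_apply]
    refine Finset.sum_eq_zero fun i _ => ?_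
    rw [hpB, smul_zero]
  have iso1 := (model_main p hT c hcbr hcgr b hb hcb hp hp0).1
  -- the quotient
  obtain ⟨f, hf, hker⟩ := hQ
  have hfbr : ∀ x y, f.toLinearMap (br F L x y) = 0 := by
    intro x y
    rw [← LinearMap.mem_ker, hker]
    exact Submodule.subset_span ⟨x, y, rfl⟩
  have hfz : f.toLinearMap zv = 0 := by
    obtain ⟨a, u, w, -, -, huw, -⟩ := key (Sum.inr (Sum.inr ()))
    rw [← huw, hfbr]
  have hkc : ∀ x, f.toLinearMap x = 0 → c x = 0 := by
    intro x hx
    rw [← LinearMap.mem_ker, hker] at hx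
    have : derivedSub F L ≤ LinearMap.ker c := by
      refine Submodule.span_le.2 ?_
      rintro _ ⟨u, w, rfl⟩
      exact hcbr u w
    exact this hx
  obtain ⟨s, hs⟩ := f.toLinearMap.exists_rightInverse_of_surjective (LinearMap.range_eq_top.2 hf)
  have hs' : ∀ q, f.toLinearMap (s q) = q := fun q => LinearMap.congr_fun hs q
  have hcs : ∀ x, c (s (f.toLinearMap x)) = c x := by
    intro x
    rw [← sub_eq_zero, ← map_sub]
    apply hkc
    rw [map_sub, hs', sub_self]
  have hQ0 : ∀ x y, br F Q x y = 0 := by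
    intro x y
    rw [← hs' x, ← hs' y, ← f.map_bracket, hfbr]
  have hQdec : ∀ x : Q, x = ∑ i, c (s x) i • f.toLinearMap (b i) := by
    intro x
    have := congrArg f.toLinearMap (hdec (s x))
    rw [hs'] at this
    simpa only [map_add, map_sum, map_smul, hfz, smul_zero, add_zero] using this
  have iso2 := (model_main (deg := dg) pQ hTQ (c ∘ₗ s) (fun x y => by rw [hQ0, map_zero])
    (by
      intro a x hx i hi
      obtain ⟨y, hy, t, ht, hyt⟩ := gr_decomp (F := F) a (s x)
      have h1 : f.toLinearMap t = x - f.toLinearMap y := by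
        rw [← hs' x, ← hyt, map_add]; abel
      have h2 : f.toLinearMap t = 0 := by
        refine gr_disj (zm3 a) ?_ (f.map_grade _ _ ht)
        rw [h1]
        exact Submodule.sub_mem _ hx (f.map_grade _ _ hy)
      show c (s x) i = 0
      rw [← hyt, map_add, hkc t h2, add_zero]
      exact hcgr a y hy i hi)
    (fun i => f.toLinearMap (b i)) (fun i => f.map_grade _ _ (hb i))
    (fun i => by rw [LinearMap.comp_apply, hcs, hcb])
    (by
      intro x y
      conv_lhs => rw [hQdec x, hQdec y]
      simp only [map_smul, LinearMap.smul_apply, map_sum, LinearMap.sum_apply]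
      rw [Fintype.sum_prod_type_right]
      simp only [Finset.smul_sum, smul_smul]
      refine Finset.sum_congr rfl fun j _ => Finset.sum_congr rfl fun i _ => ?_
      rw [mul_comm]
      rfl)
    (by
      have hBQ : ∀ i j x' y', br F TQ (pQ.pair (f.toLinearMap (B i)) (f.toLinearMap (B j)))
          (pQ.pair x' y') = 0 := by
        intro i j x' y'
        rw [pQ.rel3 _ _ _ _ _ _ (f.map_grade _ _ (hdB i)) (f.map_grade _ _ (hdB j)), hQ0]
        simp
      intro x y x' y'
      rw [hQdec x, hQdec y]
      simp only [map_smul, LinearMap.smul_apply, map_sum, LinearMap.sum_apply]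
      refine Finset.sum_eq_zero fun i _ => ?_
      rw [Finset.sum_eq_zero fun j _ => ?_, smul_zero]
      rw [hBQ, smul_zero])).2
  obtain ⟨f1, h1⟩ := iso1
  obtain ⟨f2, h2⟩ := iso2
  exact ⟨homComp f2 f1, h2.comp h1⟩
end
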